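/- arXiv:2410.00142 — 3 statements merged into one kernel-verified Lean document; each statement's English description precedes it below -/
import Mathlib

section
/- Let n ≥ 1, x₁,…,xₙ > 0, and ε ≤ 0. For the power prior π_α(α) = α^{−(1+ε)}, π_η(η) = η^{ε−1}, the posterior is improper: d(x) = +∞. -/
open MeasureTheory Filter Set

/-- The modified Bessel function of the first kind of order 0:
`I₀(x) = ∑ (x/2)^(2m) / (m!)²`. -/
noncomputable def besselI0 (x : ℝ) : ℝ :=
  ∑' m : ℕ, (x / 2) ^ (2 * m) / ((Nat.factorial m : ℝ)) ^ 2

/-- The Rician posterior normalizing constant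
`d(x) = ∫₀^∞ ∫₀^∞ π_α(α) π_η(η) ∏ᵢ [(xᵢ/α²) I₀(η xᵢ/α²)] exp(−∑ᵢ (xᵢ² + η²)/(2α²)) dη dα`,
as a Lebesgue integral with values in `[0,∞]`. -/
noncomputable def ricianD (n : ℕ) (x : Fin n → ℝ) (πα πη : ℝ → ℝ) : ENNReal :=
  ∫⁻ α in Set.Ioi (0 : ℝ), ∫⁻ η in Set.Ioi (0 : ℝ),
    ENNReal.ofReal (πα α * πη η *
      (∏ i, (x i / α ^ 2) * besselI0 (η * x i / α ^ 2)) *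
      Real.exp (-(∑ i, (x i ^ 2 + η ^ 2) / (2 * α ^ 2))))

theorem one_le_besselI0 (y : ℝ) : 1 ≤ besselI0 y := by
  have hnonneg : ∀ m : ℕ, 0 ≤ (y / 2) ^ (2 * m) / ((Nat.factorial m : ℝ)) ^ 2 := fun m =>
    div_nonneg ((even_two_mul m).pow_nonneg _) (sq_nonneg _)
  have hsum : Summable fun m : ℕ => (y / 2) ^ (2 * m) / ((Nat.factorial m : ℝ)) ^ 2 := by
    refine Summable.of_nonneg_of_le hnonneg (fun m => ?_)
      (Real.summable_pow_div_factorial ((y / 2) ^ 2))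
    rw [← pow_mul]
    have h1 : (1 : ℝ) ≤ Nat.factorial m := by
      exact_mod_cast Nat.one_le_iff_ne_zero.2 m.factorial_ne_zero
    exact div_le_div_of_nonneg_left ((even_two_mul m).pow_nonneg _) (by linarith)
      (le_self_pow₀ h1 two_ne_zero)
  simpa [besselI0] using hsum.le_tsum 0 fun m _ => hnonneg m

theorem lintegral_rpow_Ioo_eq_top {s : ℝ} (hs : s ≤ -1) :
    ∫⁻ η in Ioo (0 : ℝ) 1, ENNReal.ofReal (η ^ s) = ⊤ := by
  by_contra h
  have hmeas : AEStronglyMeasurable (fun η : ℝ => η ^ s) (volume.restrict (Ioo 0 1)) :=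
    (measurable_id.pow_const s).aestronglyMeasurable
  have hnonneg : 0 ≤ᵐ[volume.restrict (Ioo (0 : ℝ) 1)] fun η : ℝ => η ^ s :=
    (ae_restrict_iff' measurableSet_Ioo).2 (ae_of_all _ fun η hη => Real.rpow_nonneg hη.1.le s)
  have hint : IntegrableOn (fun η : ℝ => η ^ s) (Ioo 0 1) :=
    (lintegral_ofReal_ne_top_iff_integrable hmeas hnonneg).1 h
  exact hs.not_gt ((intervalIntegral.integrableOn_Ioo_rpow_iff one_pos).1 hint)

theorem lintegral_rician_power_eq_top {n : ℕ} {x : Fin n → ℝ} (hx : ∀ i, 0 < x i)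
    {ε α c : ℝ} (hε : ε ≤ 0) (hα : 0 < α) (hc : 0 < c) :
    ∫⁻ η in Ioi (0 : ℝ), ENNReal.ofReal (c * η ^ (ε - 1) *
      (∏ i, (x i / α ^ 2) * besselI0 (η * x i / α ^ 2)) *
      Real.exp (-(∑ i, (x i ^ 2 + η ^ 2) / (2 * α ^ 2)))) = ⊤ := by
  set C : ℝ := c * (∏ i, x i / α ^ 2) * Real.exp (-(∑ i, (x i ^ 2 + 1) / (2 * α ^ 2)))
  have hprod : 0 < ∏ i, x i / α ^ 2 := Finset.prod_pos fun i _ => div_pos (hx i) (by positivity)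
  have hC : 0 < C := by positivity
  have hbound : ∀ η ∈ Ioo (0 : ℝ) 1, C * η ^ (ε - 1) ≤ c * η ^ (ε - 1) *
      (∏ i, (x i / α ^ 2) * besselI0 (η * x i / α ^ 2)) *
      Real.exp (-(∑ i, (x i ^ 2 + η ^ 2) / (2 * α ^ 2))) := by
    intro η hη
    have hη0 : 0 ≤ η ^ (ε - 1) := Real.rpow_nonneg hη.1.le _
    have hle : ∏ i, x i / α ^ 2 ≤ ∏ i, (x i / α ^ 2) * besselI0 (η * x i / α ^ 2) :=
      Finset.prod_le_prod (fun i _ => (div_pos (hx i) (by positivity)).le) fun i _ =>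
        le_mul_of_one_le_right (div_pos (hx i) (by positivity)).le (one_le_besselI0 _)
    have hsq : η ^ 2 ≤ 1 := pow_le_one₀ hη.1.le hη.2.le
    calc C * η ^ (ε - 1) = c * η ^ (ε - 1) * (∏ i, x i / α ^ 2) *
          Real.exp (-(∑ i, (x i ^ 2 + 1) / (2 * α ^ 2))) := by ring
      _ ≤ _ := by
        have := hprod.le.trans hle
        gcongr
  refine top_unique ?_
  calc (⊤ : ENNReal)
      = ENNReal.ofReal C * ∫⁻ η in Ioo (0 : ℝ) 1, ENNReal.ofReal (η ^ (ε - 1)) := by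
        rw [lintegral_rpow_Ioo_eq_top (by linarith), ENNReal.mul_top (by simpa using hC)]
    _ = ∫⁻ η in Ioo (0 : ℝ) 1, ENNReal.ofReal (C * η ^ (ε - 1)) := by
        simp_rw [ENNReal.ofReal_mul hC.le]
        rw [lintegral_const_mul' _ _ ENNReal.ofReal_ne_top]
    _ ≤ ∫⁻ η in Ioo (0 : ℝ) 1, ENNReal.ofReal (c * η ^ (ε - 1) *
          (∏ i, (x i / α ^ 2) * besselI0 (η * x i / α ^ 2)) *
          Real.exp (-(∑ i, (x i ^ 2 + η ^ 2) / (2 * α ^ 2)))) :=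
        setLIntegral_mono' measurableSet_Ioo fun η hη => ENNReal.ofReal_le_ofReal (hbound η hη)
    _ ≤ _ := lintegral_mono_set Ioo_subset_Ioi_self

theorem stmt_5 (n : ℕ) (hn : 1 ≤ n) (x : Fin n → ℝ) (hx : ∀ i, 0 < x i)
    (ε : ℝ) (hε : ε ≤ 0) :
    ricianD n x (fun α => α ^ (-(1 + ε))) (fun η => η ^ (ε - 1)) = ⊤ := by
  unfold ricianD
  rw [setLIntegral_congr_fun (g := fun _ => ⊤) measurableSet_Ioi fun α hα =>
    lintegral_rician_power_eq_top hx hε hα (Real.rpow_pos_of_pos hα _)]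
  simp
end

section
/- Let ε > 0, let n be a natural number with n > 2ε, and let x₁,…,xₙ > 0 be such that not all the x_i are equal. For the power prior π_α(α) = α^{−(1+ε)}, π_η(η) = η^{ε−1}, the posterior is proper: d(x) < ∞. -/
open MeasureTheory Filter Set

theorem besselI0_le_exp {z : ℝ} (hz : 0 ≤ z) : besselI0 z ≤ Real.exp z := by
  have hcosh := Real.hasSum_cosh z
  have hle : ∀ m : ℕ, (z / 2) ^ (2 * m) / (Nat.factorial m : ℝ) ^ 2 ≤
      z ^ (2 * m) / (Nat.factorial (2 * m) : ℝ) := by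
    intro m
    have hfac : (Nat.factorial (2 * m) : ℝ) ≤ 2 ^ (2 * m) * (Nat.factorial m : ℝ) ^ 2 := by
      have h1 : Nat.choose (2 * m) m * Nat.factorial m * Nat.factorial m =
          Nat.factorial (2 * m) := by
        have := Nat.choose_mul_factorial_mul_factorial (show m ≤ 2 * m by omega)
        rwa [show 2 * m - m = m by omega] at this
      have h2 : Nat.choose (2 * m) m ≤ 2 ^ (2 * m) := Nat.choose_le_two_pow _ _
      have h3 : Nat.factorial (2 * m) ≤ 2 ^ (2 * m) * Nat.factorial m ^ 2 := by
        rw [← h1, mul_assoc, ← sq]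
        gcongr
      exact_mod_cast h3
    rw [div_pow, div_div]
    gcongr
  have hsum : Summable fun m : ℕ => (z / 2) ^ (2 * m) / (Nat.factorial m : ℝ) ^ 2 :=
    Summable.of_nonneg_of_le (fun m => by positivity) hle hcosh.summable
  calc besselI0 z ≤ Real.cosh z := by
        rw [← hcosh.tsum_eq]
        exact hsum.tsum_le_tsum hle hcosh.summable
    _ ≤ Real.exp z := by
        rw [Real.cosh_eq]
        have : Real.exp (-z) ≤ Real.exp z := Real.exp_le_exp.2 (by linarith)
        linarith

theorem besselI0_nonneg (z : ℝ) : 0 ≤ besselI0 z :=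
  tsum_nonneg fun m => by
    rw [pow_mul]
    positivity

theorem exists_mul_one_add_sq_le_sum_sq_sub {ι : Type*} [Fintype ι] (x : ι → ℝ)
    (hne : ∃ i j, x i ≠ x j) :
    ∃ c > 0, ∀ η : ℝ, c * (1 + η ^ 2) ≤ ∑ i, (x i - η) ^ 2 := by
  classical
  obtain ⟨i, j, hij⟩ := hne
  have hδ : 0 < |x i - x j| := abs_pos.2 (sub_ne_zero.2 hij)
  set K := (1 + |x i|) / |x i - x j| + 1 with hK
  have hKpos : 0 < K := by positivity
  refine ⟨1 / (2 * K ^ 2), by positivity, fun η => ?_⟩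
  have hpair : (x i - η) ^ 2 + (x j - η) ^ 2 ≤ ∑ k, (x k - η) ^ 2 := by
    have hne' : i ≠ j := fun h => hij (by rw [h])
    rw [← Finset.sum_pair (f := fun k => (x k - η) ^ 2) hne']
    exact Finset.sum_le_sum_of_subset_of_nonneg (Finset.subset_univ _)
      fun k _ _ => sq_nonneg _
  have hsep : |x i - x j| ≤ |x i - η| + |x j - η| := by
    rw [abs_sub_comm (x j) η]
    exact abs_sub_le _ _ _
  have hη : |η| ≤ |x i| + |x i - η| := by
    have := abs_sub (x i) (x i - η)
    simpa using this
  have hlin : 1 + |η| ≤ K * (|x i - η| + |x j - η|) := by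
    have h1 : 1 + |x i| ≤ (1 + |x i|) / |x i - x j| * (|x i - η| + |x j - η|) := by
      rw [div_mul_eq_mul_div, le_div_iff₀ hδ]
      gcongr
    have h2 := abs_nonneg (x j - η)
    rw [hK, add_mul, one_mul]
    linarith
  have hsq : 1 + η ^ 2 ≤ 2 * K ^ 2 * ((x i - η) ^ 2 + (x j - η) ^ 2) := by
    have h1 : (1 + |η|) ^ 2 ≤ (K * (|x i - η| + |x j - η|)) ^ 2 := by gcongr
    have h2 : (|x i - η| + |x j - η|) ^ 2 ≤ 2 * ((x i - η) ^ 2 + (x j - η) ^ 2) := by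
      rw [← sq_abs (x i - η), ← sq_abs (x j - η)]
      exact add_sq_le
    calc 1 + η ^ 2 ≤ (1 + |η|) ^ 2 := by
          rw [← sq_abs η]
          nlinarith [abs_nonneg η]
      _ ≤ K ^ 2 * (|x i - η| + |x j - η|) ^ 2 := by rwa [← mul_pow]
      _ ≤ K ^ 2 * (2 * ((x i - η) ^ 2 + (x j - η) ^ 2)) := by gcongr
      _ = _ := by ring
  rw [div_mul_eq_mul_div, one_mul, div_le_iff₀ (by positivity)]
  calc 1 + η ^ 2 ≤ 2 * K ^ 2 * ((x i - η) ^ 2 + (x j - η) ^ 2) := hsq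
    _ ≤ 2 * K ^ 2 * ∑ k, (x k - η) ^ 2 := by gcongr
    _ = _ := by ring

theorem prod_besselI0_mul_exp_le {n : ℕ} {x : Fin n → ℝ} (hx : ∀ i, 0 < x i) {α η : ℝ}
    (hη : 0 < η) :
    (∏ i, (x i / α ^ 2) * besselI0 (η * x i / α ^ 2)) *
        Real.exp (-(∑ i, (x i ^ 2 + η ^ 2) / (2 * α ^ 2))) ≤
      (∏ i, x i / α ^ 2) * Real.exp (-((∑ i, (x i - η) ^ 2) / (2 * α ^ 2))) := by
  have hprod : (∏ i, (x i / α ^ 2) * besselI0 (η * x i / α ^ 2)) ≤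
      ∏ i, (x i / α ^ 2) * Real.exp (η * x i / α ^ 2) := by
    refine Finset.prod_le_prod (fun i _ => ?_) (fun i _ => ?_)
    · have := hx i
      have := besselI0_nonneg (η * x i / α ^ 2)
      positivity
    · have := hx i
      gcongr
      exact besselI0_le_exp (by positivity)
  refine (mul_le_mul_of_nonneg_right hprod (Real.exp_nonneg _)).trans_eq ?_
  rw [Finset.prod_mul_distrib, ← Real.exp_sum, mul_assoc, ← Real.exp_add, Finset.sum_div,
    ← sub_eq_add_neg, ← Finset.sum_sub_distrib, ← Finset.sum_neg_distrib]
  congr 3 with i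
  by_cases hα : α = 0
  · simp [hα]
  · field_simp
    ring

theorem integrableOn_rpow_mul_exp_neg_div_sq {b s : ℝ} (hb : 0 < b) (hs : s < -1) :
    IntegrableOn (fun α : ℝ => α ^ s * Real.exp (-(b / α ^ 2))) (Ioi 0) := by
  have hf : IntegrableOn (fun y : ℝ => y ^ (-(s + 3) / 2) * Real.exp (-b * y)) (Ioi 0) := by
    have := integrableOn_rpow_mul_exp_neg_mul_rpow (s := -(s + 3) / 2) (p := 1) (b := b)
      (by linarith) one_pos hb
    simpa using this
  have h := ((integrableOn_Ioi_comp_rpow_iff _ (show (-2 : ℝ) ≠ 0 by norm_num)).2 hf).const_mul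
    (1 / 2)
  refine IntegrableOn.congr_fun h (fun α hα => ?_) measurableSet_Ioi
  have hα : 0 < α := hα
  have h1 : (α ^ (-2 : ℝ)) ^ (-(s + 3) / 2) = α ^ (s + 3) := by
    rw [← Real.rpow_mul hα.le]
    congr 1
    ring
  have h2 : α ^ (-2 : ℝ) = (α ^ 2)⁻¹ := by
    rw [Real.rpow_neg hα.le]
    norm_num
  have h3 : α ^ s = α ^ (-2 - 1 : ℝ) * α ^ (s + 3) := by
    rw [← Real.rpow_add hα]
    congr 1
    ring
  simp only [smul_eq_mul]
  rw [h1, h2, h3, neg_mul, ← div_eq_mul_inv, abs_neg, abs_two]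
  ring

theorem lintegral_rpow_mul_exp_neg_mul_sq {b s : ℝ} (hb : 0 < b) (hs : 0 < s) :
    ∫⁻ η in Ioi (0 : ℝ), ENNReal.ofReal (η ^ (s - 1) * Real.exp (-b * η ^ 2)) =
      ENNReal.ofReal (b ^ (-s / 2) * (1 / 2) * Real.Gamma (s / 2)) := by
  rw [← ofReal_integral_eq_lintegral_ofReal
    (integrableOn_rpow_mul_exp_neg_mul_sq hb (by linarith))]
  · have := integral_rpow_mul_exp_neg_mul_rpow (p := 2) (q := s - 1) (b := b) (by norm_num)
      (by linarith) hb
    simp only [Real.rpow_two, sub_add_cancel] at this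
    rw [this]
  · filter_upwards [ae_restrict_mem measurableSet_Ioi] with η hη
    have hη : 0 < η := hη
    simp only [Pi.zero_apply]
    positivity

theorem stmt_6 (ε : ℝ) (hε : 0 < ε) (n : ℕ) (hn : (n : ℝ) > 2 * ε)
    (x : Fin n → ℝ) (hx : ∀ i, 0 < x i) (hne : ∃ i j, x i ≠ x j) :
    ricianD n x (fun α => α ^ (-(1 + ε))) (fun η => η ^ (ε - 1)) < ⊤ := by
  obtain ⟨c, hc, hS⟩ := exists_mul_one_add_sq_le_sum_sq_sub x hne
  set b := c / 2 with hb_def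
  have hb : 0 < b := by positivity
  have hn0 : (0 : ℝ) < n := by linarith
  set C := (∏ i, x i) * (b ^ (-ε / 2) * (1 / 2) * Real.Gamma (ε / 2)) with hC
  have hP : 0 < ∏ i, x i := Finset.prod_pos fun i _ => hx i
  have hg : IntegrableOn
      (fun α : ℝ => C * (α ^ (-(1 + 2 * n) : ℝ) * Real.exp (-(b / α ^ 2)))) (Ioi 0) :=
    (integrableOn_rpow_mul_exp_neg_div_sq hb (by linarith)).const_mul C
  refine lt_of_le_of_lt (setLIntegral_mono' measurableSet_Ioi fun α hα => ?_)
    hg.lintegral_lt_top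
  have hα : 0 < α := hα
  set A := α ^ (-(1 + ε)) * ((∏ i, x i / α ^ 2) * Real.exp (-(b / α ^ 2))) with hA
  have hA0 : 0 ≤ A :=
    mul_nonneg (by positivity) (mul_nonneg
      (Finset.prod_nonneg fun i _ => div_nonneg (hx i).le (by positivity)) (Real.exp_nonneg _))
  have hbound : ∀ η ∈ Ioi (0 : ℝ),
      ENNReal.ofReal (α ^ (-(1 + ε)) * η ^ (ε - 1) *
        (∏ i, (x i / α ^ 2) * besselI0 (η * x i / α ^ 2)) *
        Real.exp (-(∑ i, (x i ^ 2 + η ^ 2) / (2 * α ^ 2)))) ≤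
      ENNReal.ofReal A *
        ENNReal.ofReal (η ^ (ε - 1) * Real.exp (-(b / α ^ 2) * η ^ 2)) := by
    intro η hη
    have hη : 0 < η := hη
    rw [← ENNReal.ofReal_mul hA0]
    refine ENNReal.ofReal_le_ofReal ?_
    have hQ : 0 ≤ ∏ i, x i / α ^ 2 :=
      Finset.prod_nonneg fun i _ => div_nonneg (hx i).le (by positivity)
    have hexp : Real.exp (-((∑ i, (x i - η) ^ 2) / (2 * α ^ 2))) ≤
        Real.exp (-(b / α ^ 2)) * Real.exp (-(b / α ^ 2) * η ^ 2) := by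
      rw [← Real.exp_add, Real.exp_le_exp]
      have h1 : c * (1 + η ^ 2) / (2 * α ^ 2) ≤ (∑ i, (x i - η) ^ 2) / (2 * α ^ 2) := by
        gcongr
        exact hS η
      have h2 : c * (1 + η ^ 2) / (2 * α ^ 2) = b / α ^ 2 + b / α ^ 2 * η ^ 2 := by
        rw [hb_def]
        field_simp
      linarith
    rw [mul_assoc (α ^ (-(1 + ε)) * η ^ (ε - 1))]
    calc _ ≤ α ^ (-(1 + ε)) * η ^ (ε - 1) * ((∏ i, x i / α ^ 2) *
            (Real.exp (-(b / α ^ 2)) * Real.exp (-(b / α ^ 2) * η ^ 2))) := by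
          refine mul_le_mul_of_nonneg_left ?_ (by positivity)
          exact (prod_besselI0_mul_exp_le hx hη).trans (mul_le_mul_of_nonneg_left hexp hQ)
      _ = _ := by
          rw [hA]
          ring
  refine (setLIntegral_mono' measurableSet_Ioi hbound).trans_eq ?_
  rw [lintegral_const_mul' _ _ ENNReal.ofReal_ne_top,
    lintegral_rpow_mul_exp_neg_mul_sq (by positivity) hε, ← ENNReal.ofReal_mul hA0]
  congr 1
  have h1 : (b / α ^ 2) ^ (-ε / 2) = b ^ (-ε / 2) * α ^ ε := by
    rw [Real.div_rpow hb.le (by positivity), ← Real.rpow_natCast α 2, ← Real.rpow_mul hα.le,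
      div_eq_mul_inv, ← Real.rpow_neg hα.le]
    congr 2
    push_cast
    ring
  have h2 : ∏ i, x i / α ^ 2 = (∏ i, x i) * α ^ (-(2 * n) : ℝ) := by
    rw [Finset.prod_div_distrib, Finset.prod_const, Finset.card_univ, Fintype.card_fin,
      ← pow_mul, div_eq_mul_inv, Real.rpow_neg hα.le, ← Real.rpow_natCast]
    push_cast
    rfl
  have h3 : α ^ (-(1 + 2 * n) : ℝ) = α ^ (-(1 + ε)) * α ^ (-(2 * n) : ℝ) * α ^ ε := by
    rw [← Real.rpow_add hα, ← Real.rpow_add hα]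
    congr 1
    ring
  rw [hA, hC, h1, h2, h3]
  ring
end

section
/- Assume n ≥ 2, x₁,…,xₙ > 0 not all equal, r₀ > −1, r∞ ∈ ℝ, k ∈ ℝ with n > max(2(r∞+1), k+1), and π_η : (0,∞) → (0,∞) continuous with π_η(η) ∝_{η→0⁺} η^{r₀} and π_η(η) ∝_{η→∞} η^{r∞}. Then s₁ := ∫₀^∞ ∫₀^1 h(β,η) dβ dη < ∞. -/
open MeasureTheory Filter Set

/-- `I₀*(y) = e^(−y) I₀(y)`. -/
noncomputable def besselI0star (y : ℝ) : ℝ := Real.exp (-y) * besselI0 y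

/-- `a(t) ∝ b(t)` along the filter `l`: the liminf of `a/b` is positive and the
limsup of `a/b` is finite (computed in `[0,∞]`). -/
def PropAt (a b : ℝ → ℝ) (l : Filter ℝ) : Prop :=
  0 < Filter.liminf (fun t => ENNReal.ofReal (a t / b t)) l ∧
    Filter.limsup (fun t => ENNReal.ofReal (a t / b t)) l < ⊤

/-- `h(β,η) = π_η(η)·β^(n−(k+3)/2)·η^((k+1)/2−n)·∏ᵢ I₀*(β xᵢ)·exp(−β ∑ᵢ (xᵢ−η)²/(2η))`. -/
noncomputable def hFun (n : ℕ) (x : Fin n → ℝ) (k : ℝ) (πη : ℝ → ℝ) (β η : ℝ) : ℝ :=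
  πη η * β ^ ((n : ℝ) - (k + 3) / 2) * η ^ ((k + 1) / 2 - (n : ℝ)) *
    (∏ i, besselI0star (β * x i)) *
    Real.exp (-(β * ∑ i, (x i - η) ^ 2 / (2 * η)))

lemma besselI0_term_le (y : ℝ) (m : ℕ) :
    (y / 2) ^ (2 * m) / (Nat.factorial m : ℝ) ^ 2 ≤ y ^ (2 * m) / (Nat.factorial (2 * m) : ℝ) := by
  have h1 : (Nat.factorial (2 * m) : ℝ) ≤ 4 ^ m * (Nat.factorial m : ℝ) ^ 2 := by
    have h := Nat.choose_mul_factorial_mul_factorial (show m ≤ 2 * m by omega)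
    have h4 : (2 * m).choose m ≤ 4 ^ m := by
      have := Nat.choose_le_two_pow (2 * m) m
      rwa [pow_mul] at this
    rw [show 2 * m - m = m by omega] at h
    rw [← h]
    push_cast
    have h5 : ((2 * m).choose m : ℝ) ≤ 4 ^ m := by exact_mod_cast h4
    nlinarith [sq_nonneg (Nat.factorial m : ℝ)]
  have hy : (y / 2) ^ (2 * m) = y ^ (2 * m) / 4 ^ m := by
    rw [div_pow, pow_mul (2 : ℝ)]; norm_num
  rw [hy, div_div]
  exact div_le_div_of_nonneg_left (by rw [pow_mul]; positivity) (by positivity) h1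

lemma besselI0_term_nonneg (y : ℝ) (m : ℕ) :
    0 ≤ (y / 2) ^ (2 * m) / (Nat.factorial m : ℝ) ^ 2 := by
  rw [pow_mul]; positivity

lemma besselI0_le_cosh (y : ℝ) : besselI0 y ≤ Real.cosh y := by
  have hc := Real.hasSum_cosh y
  rw [← hc.tsum_eq]
  exact (hc.summable.of_nonneg_of_le (besselI0_term_nonneg y)
    (besselI0_term_le y)).tsum_le_tsum (besselI0_term_le y) hc.summable

lemma besselI0star_nonneg (y : ℝ) : 0 ≤ besselI0star y :=
  mul_nonneg (Real.exp_pos _).le (tsum_nonneg (besselI0_term_nonneg y))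

lemma besselI0star_le_one {y : ℝ} (hy : 0 ≤ y) : besselI0star y ≤ 1 := by
  have h : besselI0 y ≤ Real.exp y := by
    refine (besselI0_le_cosh y).trans ?_
    rw [Real.cosh_eq]
    linarith [Real.exp_le_exp.2 (show -y ≤ y by linarith)]
  calc besselI0star y ≤ Real.exp (-y) * Real.exp y :=
        mul_le_mul_of_nonneg_left h (Real.exp_pos _).le
    _ = 1 := by rw [← Real.exp_add]; simp

lemma PropAt.exists_eventually_le {a b : ℝ → ℝ} {l : Filter ℝ} (h : PropAt a b l)
    (hb : ∀ᶠ t in l, 0 < b t) : ∃ C : ℝ, 0 ≤ C ∧ ∀ᶠ t in l, a t ≤ C * b t := by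
  obtain ⟨C, hC, hC'⟩ := exists_between h.2
  refine ⟨C.toReal, ENNReal.toReal_nonneg, ?_⟩
  filter_upwards [eventually_lt_of_limsup_lt hC, hb] with t ht hbt
  rw [← div_le_iff₀ hbt]
  exact (ENNReal.ofReal_le_iff_le_toReal hC'.ne).1 ht.le

lemma lintegral_rpow_mul_exp_neg_mul_Ioi {a r : ℝ} (ha : 0 < a) (hr : 0 < r) :
    ∫⁻ t in Ioi (0 : ℝ), ENNReal.ofReal (t ^ (a - 1) * Real.exp (-(r * t))) =
      ENNReal.ofReal ((1 / r) ^ a * Real.Gamma a) := by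
  rw [← Real.integral_rpow_mul_exp_neg_mul_Ioi ha hr, ofReal_integral_eq_lintegral_ofReal]
  · have := integrableOn_rpow_mul_exp_neg_mul_rpow (p := 1) (s := a - 1) (by linarith) one_pos hr
    simpa [IntegrableOn, neg_mul] using this
  · filter_upwards [ae_restrict_mem measurableSet_Ioi] with t ht
    have : (0 : ℝ) < t := ht
    positivity

lemma sq_sub_le_two_mul_sum_sq_sub {n : ℕ} (x : Fin n → ℝ) {i j : Fin n} (hij : i ≠ j) (η : ℝ) :
    (x i - x j) ^ 2 ≤ 2 * ∑ l, (x l - η) ^ 2 := by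
  have h : ∑ l ∈ {i, j}, (x l - η) ^ 2 ≤ ∑ l, (x l - η) ^ 2 :=
    Finset.sum_le_sum_of_subset_of_nonneg (Finset.subset_univ _) fun _ _ _ => sq_nonneg _
  rw [Finset.sum_pair hij] at h
  nlinarith [sq_nonneg (x i - η + (x j - η))]

lemma sq_div_four_le_sum_sq_sub {n : ℕ} (x : Fin n → ℝ) (i : Fin n) {η : ℝ} (hx : 0 ≤ x i)
    (hη : 2 * x i ≤ η) : η ^ 2 / 4 ≤ ∑ l, (x l - η) ^ 2 := by
  have h : (x i - η) ^ 2 ≤ ∑ l, (x l - η) ^ 2 :=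
    Finset.single_le_sum (f := fun l => (x l - η) ^ 2) (fun _ _ => sq_nonneg _)
      (Finset.mem_univ i)
  nlinarith

lemma integrableOn_mul_sum_sq_rpow_neg {n : ℕ} {x : Fin n → ℝ} (hx : ∀ i, 0 < x i)
    (hne : ∃ i j, x i ≠ x j) {a r₀ rinf : ℝ} (ha : 0 < a) (hr₀ : -1 < r₀)
    (hinf : rinf - 2 * a < -1) {p : ℝ → ℝ} (hp : ContinuousOn p (Ioi 0))
    (hpos : ∀ η : ℝ, 0 < η → 0 < p η)
    (hprop0 : PropAt p (fun η => η ^ r₀) (nhdsWithin 0 (Ioi 0)))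
    (hpropInf : PropAt p (fun η => η ^ rinf) atTop) :
    IntegrableOn (fun η => p η * (∑ i, (x i - η) ^ 2) ^ (-a)) (Ioi 0) := by
  obtain ⟨i, j, hij⟩ := hne
  have hij' : i ≠ j := fun h => hij (by rw [h])
  have hc : 0 < (x i - x j) ^ 2 / 2 := by
    have : x i - x j ≠ 0 := sub_ne_zero.2 hij
    positivity
  have hQ (η : ℝ) : (x i - x j) ^ 2 / 2 ≤ ∑ l, (x l - η) ^ 2 := by
    linarith [sq_sub_le_two_mul_sum_sq_sub x hij' η]
  have hcont : ContinuousOn (fun η => p η * (∑ i, (x i - η) ^ 2) ^ (-a)) (Ioi 0) := by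
    refine hp.mul (ContinuousOn.rpow_const (by fun_prop) fun η _ => Or.inl ?_)
    exact (hc.trans_le (hQ η)).ne'
  obtain ⟨C, hC, hC0⟩ := hprop0.exists_eventually_le (by
    filter_upwards [self_mem_nhdsWithin] with t ht using Real.rpow_pos_of_pos ht _)
  obtain ⟨D, hD, hDinf⟩ := hpropInf.exists_eventually_le (by
    filter_upwards [eventually_gt_atTop 0] with t ht using Real.rpow_pos_of_pos ht _)
  obtain ⟨δ, hδ, hδ'⟩ := mem_nhdsGT_iff_exists_Ioc_subset.1 hC0
  have hδ0 : (0 : ℝ) < δ := hδ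
  obtain ⟨M, hM⟩ := eventually_atTop.1 (hDinf.and (eventually_ge_atTop (max δ (2 * x i))))
  have hδM : δ ≤ M := (le_max_left _ _).trans (hM M le_rfl).2
  have hnorm {η : ℝ} (hη : 0 < η) : ‖p η * (∑ i, (x i - η) ^ 2) ^ (-a)‖ =
      p η * (∑ i, (x i - η) ^ 2) ^ (-a) :=
    Real.norm_of_nonneg (mul_nonneg (hpos η hη).le
      (Real.rpow_nonneg (hc.le.trans (hQ η)) _))
  have h0 : IntegrableOn (fun η => p η * (∑ i, (x i - η) ^ 2) ^ (-a)) (Ioc 0 δ) := by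
    have hg : IntegrableOn (fun η : ℝ => C * η ^ r₀ * ((x i - x j) ^ 2 / 2) ^ (-a)) (Ioc 0 δ) :=
      (((intervalIntegrable_iff_integrableOn_Ioc_of_le hδ0.le).1
        (intervalIntegral.intervalIntegrable_rpow' hr₀)).const_mul C).mul_const _
    refine Integrable.mono' hg
      ((hcont.mono Ioc_subset_Ioi_self).aestronglyMeasurable measurableSet_Ioc) ?_
    filter_upwards [ae_restrict_mem measurableSet_Ioc] with η hη
    rw [hnorm hη.1]
    exact mul_le_mul (hδ' hη) (Real.rpow_le_rpow_of_nonpos hc (hQ η) (by linarith))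
      (Real.rpow_nonneg (hc.le.trans (hQ η)) _)
      (mul_nonneg hC (Real.rpow_nonneg hη.1.le _))
  have h1 : IntegrableOn (fun η => p η * (∑ i, (x i - η) ^ 2) ^ (-a)) (Icc δ M) :=
    (hcont.mono fun η hη => hδ0.trans_le hη.1).integrableOn_Icc
  have h2 : IntegrableOn (fun η => p η * (∑ i, (x i - η) ^ 2) ^ (-a)) (Ioi M) := by
    have hg : IntegrableOn (fun η : ℝ => D * 4 ^ a * η ^ (rinf - 2 * a)) (Ioi M) :=
      (integrableOn_Ioi_rpow_of_lt hinf (hδ0.trans_le hδM)).const_mul _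
    refine Integrable.mono' hg ((hcont.mono (Ioi_subset_Ioi
      (hδ0.le.trans hδM))).aestronglyMeasurable measurableSet_Ioi) ?_
    filter_upwards [ae_restrict_mem measurableSet_Ioi] with η hη
    have hη0 : 0 < η := (hδ0.trans_le hδM).trans hη
    obtain ⟨hpη, hmax⟩ := hM η (le_of_lt hη)
    have hQη := sq_div_four_le_sum_sq_sub x i (hx i).le ((le_max_right _ _).trans hmax)
    rw [hnorm hη0]
    have hpow : (η ^ 2 / 4) ^ (-a) = 4 ^ a * η ^ (-(2 * a)) := by
      rw [Real.div_rpow (by positivity) (by norm_num), ← Real.rpow_natCast η 2,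
        ← Real.rpow_mul hη0.le, Real.rpow_neg (by norm_num : (0 : ℝ) ≤ 4), div_inv_eq_mul,
        mul_comm]
      push_cast
      ring_nf
    calc p η * (∑ i, (x i - η) ^ 2) ^ (-a)
        ≤ D * η ^ rinf * (η ^ 2 / 4) ^ (-a) :=
          mul_le_mul hpη (Real.rpow_le_rpow_of_nonpos (by positivity) hQη (by linarith))
            (Real.rpow_nonneg (hc.le.trans (hQ η)) _) (by positivity)
      _ = D * 4 ^ a * η ^ (rinf - 2 * a) := by
          rw [hpow, sub_eq_add_neg, Real.rpow_add hη0]; ring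
  refine ((h0.union h1).union h2).mono_set fun η hη => ?_
  have : (0 : ℝ) < η := hη
  rcases le_total η δ with h | h
  · exact Or.inl (Or.inl ⟨hη, h⟩)
  · rcases le_or_gt η M with h' | h'
    · exact Or.inl (Or.inr ⟨h, h'⟩)
    · exact Or.inr h'

lemma hFun_le {n : ℕ} {x : Fin n → ℝ} (hx : ∀ i, 0 < x i) (k : ℝ) {p : ℝ → ℝ} {β η : ℝ}
    (hβ : 0 < β) (hη : 0 < η) (hp : 0 ≤ p η) :
    hFun n x k p β η ≤ p η * η ^ (-((n : ℝ) - (k + 1) / 2)) *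
      (β ^ ((n : ℝ) - (k + 1) / 2 - 1) *
        Real.exp (-((∑ i, (x i - η) ^ 2) / (2 * η) * β))) := by
  have hprod : ∏ i, besselI0star (β * x i) ≤ 1 :=
    Finset.prod_le_one (fun i _ => besselI0star_nonneg _)
      fun i _ => besselI0star_le_one (mul_pos hβ (hx i)).le
  unfold hFun
  rw [← Finset.sum_div, mul_comm β (_ / _), neg_sub,
    show (n : ℝ) - (k + 1) / 2 - 1 = n - (k + 3) / 2 by ring]
  calc _ ≤ p η * β ^ ((n : ℝ) - (k + 3) / 2) * η ^ ((k + 1) / 2 - (n : ℝ)) * 1 *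
        Real.exp (-((∑ i, (x i - η) ^ 2) / (2 * η) * β)) := by gcongr
    _ = _ := by ring

theorem stmt_11 (n : ℕ) (hn : 2 ≤ n) (x : Fin n → ℝ) (hx : ∀ i, 0 < x i)
    (hne : ∃ i j, x i ≠ x j)
    (k r₀ rinf : ℝ) (hr₀ : r₀ > -1)
    (hnbig : (n : ℝ) > max (2 * (rinf + 1)) (k + 1))
    (πη : ℝ → ℝ) (hπη : ContinuousOn πη (Set.Ioi 0))
    (hπηpos : ∀ η : ℝ, 0 < η → 0 < πη η)
    (hprop0 : PropAt πη (fun η => η ^ r₀) (nhdsWithin 0 (Set.Ioi 0)))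
    (hpropInf : PropAt πη (fun η => η ^ rinf) Filter.atTop) :
    (∫⁻ η in Set.Ioi (0 : ℝ), ∫⁻ β in Set.Ioo (0 : ℝ) 1,
      ENNReal.ofReal (hFun n x k πη β η)) < ⊤ := by
  obtain ⟨hn1, hn2⟩ := max_lt_iff.1 hnbig
  have hn0 : (2 : ℝ) ≤ n := by exact_mod_cast hn
  set a : ℝ := n - (k + 1) / 2 with ha_def
  have ha : 0 < a := by linarith
  have hint := (integrableOn_mul_sum_sq_rpow_neg hx hne ha hr₀ (by linarith) hπη hπηpos hprop0
    hpropInf).mul_const (2 ^ a * Real.Gamma a)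
  refine lt_of_le_of_lt (setLIntegral_mono' measurableSet_Ioi fun η hη => ?_)
    hint.lintegral_lt_top
  have hη0 : (0 : ℝ) < η := hη
  obtain ⟨i, j, hij⟩ := hne
  have hQ : 0 < ∑ i, (x i - η) ^ 2 := by
    have : 0 < (x i - x j) ^ 2 := sq_pos_of_ne_zero (sub_ne_zero.2 hij)
    linarith [sq_sub_le_two_mul_sum_sq_sub x (fun h => hij (by rw [h])) η (i := i) (j := j)]
  have hc : 0 ≤ πη η * η ^ (-a) := mul_nonneg (hπηpos η hη0).le (Real.rpow_nonneg hη0.le _)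
  calc ∫⁻ β in Ioo (0 : ℝ) 1, ENNReal.ofReal (hFun n x k πη β η)
      ≤ ∫⁻ β in Ioo (0 : ℝ) 1, ENNReal.ofReal (πη η * η ^ (-a)) *
          ENNReal.ofReal (β ^ (a - 1) *
            Real.exp (-((∑ i, (x i - η) ^ 2) / (2 * η) * β))) := by
        refine setLIntegral_mono' measurableSet_Ioo fun β hβ => ?_
        rw [← ENNReal.ofReal_mul hc]
        exact ENNReal.ofReal_le_ofReal (hFun_le hx k hβ.1 hη0 (hπηpos η hη0).le)
    _ ≤ ∫⁻ β in Ioi (0 : ℝ), ENNReal.ofReal (πη η * η ^ (-a)) *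
          ENNReal.ofReal (β ^ (a - 1) *
            Real.exp (-((∑ i, (x i - η) ^ 2) / (2 * η) * β))) :=
        lintegral_mono_set Ioo_subset_Ioi_self
    _ = ENNReal.ofReal (πη η * (∑ i, (x i - η) ^ 2) ^ (-a) * (2 ^ a * Real.Gamma a)) := by
        rw [lintegral_const_mul' _ _ ENNReal.ofReal_ne_top,
          lintegral_rpow_mul_exp_neg_mul_Ioi ha (by positivity), ← ENNReal.ofReal_mul hc]
        congr 1
        rw [one_div_div, Real.div_rpow (by positivity) hQ.le,
          Real.mul_rpow (by norm_num) hη0.le, Real.rpow_neg hη0.le, Real.rpow_neg hQ.le]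
        have := Real.rpow_pos_of_pos hη0 a
        have := Real.rpow_pos_of_pos hQ a
        field_simp
end
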